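/- For every density f ∈ F_d and every bandwidth h > 0, the integrated squared bias of the sinc kernel estimator satisfies ∫ (E_f f̂_n(x) − f(x))² dx ≤ d · 2^{1−d} · π^{−d/2} · exp(−1/h²). -/

import Mathlib

open MeasureTheory Real ENNReal

noncomputable def gauss (x : ℝ) : ℝ := Real.exp (-(x^2)/2) / Real.sqrt (2*Real.pi)

noncomputable def mixDensity (d : ℕ) (G : Measure (Fin d → ℝ)) : (Fin d → ℝ) → ℝ :=
  fun x => ∫ u, ∏ i, gauss (x i - u i) ∂G

def gaussMixtures (d : ℕ) : Set ((Fin d → ℝ) → ℝ) :=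
  {f | ∃ G : Measure (Fin d → ℝ), IsProbabilityMeasure G ∧ f = mixDensity d G}

/-- The sinc kernel `K(y) = sin y / (π y)` (with its continuous value `1/π` at `0`). -/
noncomputable def sincK (y : ℝ) : ℝ :=
  if y = 0 then 1 / Real.pi else Real.sin y / (Real.pi * y)

/-- The sinc kernel density estimator with bandwidth `h` based on samples `X 0, …, X (n-1)`. -/
noncomputable def sincEst (d n : ℕ) (h : ℝ) (X : Fin n → Fin d → ℝ)
    (x : Fin d → ℝ) : ℝ :=
  (1 / (n * h^d)) * ∑ i : Fin n, ∏ j : Fin d, sincK ((X i j - x j) / h)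

noncomputable def jointMeasure (d n : ℕ) (f : (Fin d → ℝ) → ℝ) :
    Measure (Fin n → Fin d → ℝ) :=
  volume.withDensity (fun X => ∏ i, ENNReal.ofReal (f (X i)))

/-- The pointwise mean `E_f f̂_n(x)` of the sinc kernel estimator. -/
noncomputable def sincEstMean (d n : ℕ) (f : (Fin d → ℝ) → ℝ) (h : ℝ)
    (x : Fin d → ℝ) : ℝ :=
  ∫ X, sincEst d n h X x ∂(jointMeasure d n f)


lemma aux_cosG (b : ℝ) (hb : 0 < b) (s : ℝ) :
    ∫ t : ℝ, Real.cos (s * t) * Real.exp (-b * t^2) = √(π / b) * Real.exp (-s^2/(4*b)) := by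
  have h := fourierIntegral_gaussian (b := (b:ℂ)) (by simpa using hb) (s:ℂ)
  have hint : Integrable (fun x : ℝ => Complex.exp (Complex.I * s * x) * Complex.exp (-b * x^2)) := by
    have := integrable_cexp_quadratic (b := (b:ℂ)) (by simpa using hb) (Complex.I * s) 0
    refine this.congr (Filter.Eventually.of_forall fun x => ?_)
    simp only [← Complex.exp_add]
    congr 1; ring
  have h2 := integral_re (𝕜 := ℂ) hint
  rw [h] at h2
  have e1 : ∀ x : ℝ, RCLike.re (Complex.exp (Complex.I * s * x) * Complex.exp (-b * x^2))
      = Real.cos (s * x) * Real.exp (-b * x^2) := by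
    intro x
    have : Complex.exp (Complex.I * s * x) = Complex.exp (((s * x : ℝ) : ℂ) * Complex.I) := by
      congr 1; push_cast; ring
    rw [this]
    have h3 : Complex.exp (-b * x^2) = ((Real.exp (-b * x^2) : ℝ) : ℂ) := by push_cast; rfl
    rw [h3]
    simp only [RCLike.re_eq_complex_re, Complex.re_mul_ofReal, Complex.exp_ofReal_mul_I_re]
  have e2 : ((π:ℂ) / (b:ℂ)) ^ (1/2 : ℂ) * Complex.exp (-(s:ℂ)^2/(4*(b:ℂ)))
      = ((√(π / b) * Real.exp (-s^2/(4*b)) : ℝ) : ℂ) := by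
    push_cast
    congr 1
    rw [Real.sqrt_eq_rpow, Complex.ofReal_cpow (by positivity)]
    push_cast; rfl
  rw [e2] at h2
  simp only [e1] at h2
  rw [h2]; simp only [RCLike.re_eq_complex_re, Complex.ofReal_re]

lemma aux_gauss_cont : Continuous gauss := by unfold gauss; fun_prop

lemma aux_gauss_eq (x : ℝ) : gauss x = (√(2*π))⁻¹ * Real.exp (-(1/2) * x^2) := by
  unfold gauss; rw [div_eq_inv_mul]; congr 2; ring

lemma aux_gauss_pos (x : ℝ) : 0 < gauss x := by rw [aux_gauss_eq]; positivity

lemma aux_gauss_le (x : ℝ) : gauss x ≤ 1 := by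
  rw [aux_gauss_eq]
  have h1 : Real.exp (-(1/2) * x^2) ≤ 1 := Real.exp_le_one_iff.2 (by nlinarith [sq_nonneg x])
  have h2 : (√(2*π))⁻¹ ≤ 1 := inv_le_one_of_one_le₀ (by
    rw [Real.one_le_sqrt]; nlinarith [Real.pi_gt_three])
  exact mul_le_one₀ h2 (Real.exp_pos _).le h1

lemma aux_gauss_int : Integrable gauss := by
  have := (integrable_exp_neg_mul_sq (b := 1/2) (by norm_num)).const_mul (√(2*π))⁻¹
  exact this.congr (Filter.Eventually.of_forall fun x => (aux_gauss_eq x).symm)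

lemma aux_gauss_cos (s : ℝ) : ∫ t, Real.cos (s * t) * gauss t = Real.exp (-s^2/2) := by
  have h := aux_cosG (1/2) (by norm_num) s
  have : ∀ t, Real.cos (s * t) * gauss t
      = (√(2*π))⁻¹ * (Real.cos (s * t) * Real.exp (-(1/2) * t^2)) := by
    intro t; rw [aux_gauss_eq]; ring
  simp_rw [this]
  rw [integral_const_mul, h]
  have : π / (1/2) = 2 * π := by ring
  rw [this, ← mul_assoc, inv_mul_cancel₀ (by positivity), one_mul]
  congr 1; ring

lemma aux_gauss_one : ∫ t, gauss t = 1 := by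
  have := aux_gauss_cos 0
  simpa using this

lemma aux_gauss_neg (x : ℝ) : gauss (-x) = gauss x := by simp [gauss]

lemma aux_gauss_sin (s : ℝ) : ∫ t, Real.sin (s * t) * gauss t = 0 := by
  have h := integral_neg_eq_self (fun t => Real.sin (s * t) * gauss t) (volume : Measure ℝ)
  simp only [aux_gauss_neg, mul_neg, Real.sin_neg, neg_mul, integral_neg] at h
  linarith

lemma aux_gauss_shift (s x u : ℝ) :
    ∫ y, Real.cos (s * (y - x)) * gauss (y - u) = Real.cos (s * (x - u)) * Real.exp (-s^2/2) := by
  rw [← integral_add_right_eq_self _ u]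
  have : ∀ y, Real.cos (s * (y + u - x)) * gauss (y + u - u)
      = Real.cos (s*(x-u)) * (Real.cos (s*y) * gauss y)
        + Real.sin (s*(x-u)) * (Real.sin (s*y) * gauss y) := by
    intro y
    have : s * (y + u - x) = s * y - s * (x - u) := by ring
    rw [this, Real.cos_sub, add_sub_cancel_right]; ring
  simp_rw [this]
  rw [integral_add, integral_const_mul, integral_const_mul, aux_gauss_cos, aux_gauss_sin]
  · ring
  · apply Integrable.const_mul
    refine aux_gauss_int.bdd_mul (c := 1) (by fun_prop) (Filter.Eventually.of_forall fun t => ?_)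
    exact Real.abs_cos_le_one _
  · apply Integrable.const_mul
    refine aux_gauss_int.bdd_mul (c := 1) (by fun_prop) (Filter.Eventually.of_forall fun t => ?_)
    exact Real.abs_sin_le_one _

lemma aux_gauss_sq : ∫ t, gauss t * gauss t = 1 / (2 * √π) := by
  have : ∀ t, gauss t * gauss t = (2*π)⁻¹ * Real.exp (-1 * t^2) := by
    intro t
    rw [aux_gauss_eq]
    have h1 : (√(2*π))⁻¹ * (√(2*π))⁻¹ = (2*π)⁻¹ := by
      rw [← mul_inv, Real.mul_self_sqrt (by positivity)]
    rw [mul_mul_mul_comm, h1, ← Real.exp_add]; congr 2; ring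
  simp_rw [this]
  rw [integral_const_mul, integral_gaussian, div_one]
  have : π = √π * √π := (Real.mul_self_sqrt Real.pi_pos.le).symm
  have h0 : 0 < √π := by positivity
  field_simp
  rw [sq, ← this]

lemma aux_gauss_sq_int : Integrable (fun t => gauss t * gauss t) := by
  refine aux_gauss_int.bdd_mul (c := 1) aux_gauss_cont.aestronglyMeasurable (Filter.Eventually.of_forall fun t => ?_)
  rw [Real.norm_eq_abs, abs_of_pos (aux_gauss_pos t)]; exact aux_gauss_le t

/-- frequency window measure -/
noncomputable def auxNu (a : ℝ) : Measure ℝ := volume.restrict (Set.Ioc (-a) a)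

instance (a : ℝ) : IsFiniteMeasure (auxNu a) := by unfold auxNu; infer_instance

/-- smoothed Gaussian -/
noncomputable def auxG (a t : ℝ) : ℝ :=
  (2*π)⁻¹ * ∫ s, Real.cos (s * t) * Real.exp (-s^2/2) ∂(auxNu a)

noncomputable def auxA (a : ℝ) : ℝ := (2*π)⁻¹ * ∫ s, Real.exp (-s^2) ∂(auxNu a)

lemma aux_w_le (s : ℝ) : Real.exp (-s^2/2) ≤ 1 :=
  Real.exp_le_one_iff.2 (by nlinarith [sq_nonneg s])

lemma aux_cw_le (s t : ℝ) : ‖Real.cos (s * t) * Real.exp (-s^2/2)‖ ≤ 1 := by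
  rw [norm_mul]
  refine mul_le_one₀ (Real.abs_cos_le_one _) (norm_nonneg _) ?_
  rw [Real.norm_eq_abs, abs_of_pos (Real.exp_pos _)]; exact aux_w_le s

lemma aux_G_cont (a : ℝ) : Continuous (auxG a) := by
  unfold auxG
  refine continuous_const.mul ?_
  refine continuous_of_dominated (bound := fun _ => 1) (fun t => by fun_prop) ?_
    (integrable_const _) ?_
  · intro t; exact Filter.Eventually.of_forall fun s => aux_cw_le s t
  · exact Filter.Eventually.of_forall fun s => by fun_prop

lemma aux_G_bdd (a : ℝ) : ∃ C, 0 ≤ C ∧ ∀ t, |auxG a t| ≤ C := by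
  refine ⟨(2*π)⁻¹ * (1 * (auxNu a).real Set.univ), by positivity, fun t => ?_⟩
  unfold auxG
  rw [abs_mul, abs_of_pos (by positivity : (0:ℝ) < (2*π)⁻¹)]
  gcongr
  exact norm_integral_le_of_norm_le_const (Filter.Eventually.of_forall fun s => aux_cw_le s t)

lemma aux_sinc (h : ℝ) (hh : 0 < h) (y : ℝ) :
    (1/h) * sincK (y / h) = (2*π)⁻¹ * ∫ s, Real.cos (s * y) ∂(auxNu (1/h)) := by
  unfold auxNu
  rw [← intervalIntegral.integral_of_le (by have : 0 < 1/h := by positivity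
                                            linarith)]
  unfold sincK
  by_cases hy : y = 0
  · subst hy; simp; field_simp; norm_num
  · rw [if_neg (by positivity)]
    rw [intervalIntegral.integral_comp_mul_right (fun x => Real.cos x) hy, integral_cos]
    have : -(1/h) * y = -(y/h) := by ring
    rw [this, Real.sin_neg]
    have : 1/h*y = y/h := by ring
    rw [this]
    simp only [smul_eq_mul]
    field_simp
    ring

lemma aux_mean1 (h : ℝ) (hh : 0 < h) (x u : ℝ) :
    (1/h) * ∫ y, sincK ((y - x)/h) * gauss (y - u) = auxG (1/h) (x - u) := by
  rw [← integral_const_mul]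
  have : ∀ y, (1/h) * (sincK ((y - x)/h) * gauss (y - u))
      = (2*π)⁻¹ * ∫ s, Real.cos (s * (y-x)) * gauss (y - u) ∂(auxNu (1/h)) := by
    intro y
    rw [← mul_assoc, aux_sinc h hh, integral_mul_const, mul_assoc]
  simp_rw [this]
  rw [integral_const_mul, integral_integral_swap]
  · simp_rw [aux_gauss_shift]; rfl
  · have h1 : Integrable (fun z : ℝ × ℝ => gauss (z.1 - u) * (1:ℝ)) (volume.prod (auxNu (1/h))) :=
      (aux_gauss_int.comp_sub_right u).mul_prod (integrable_const (1:ℝ))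
    refine h1.mono ?_ (Filter.Eventually.of_forall fun z => ?_)
    · have := aux_gauss_cont
      apply Continuous.aestronglyMeasurable
      unfold Function.uncurry; fun_prop
    · simp only [Function.uncurry, mul_one, norm_mul]
      exact mul_le_of_le_one_left (norm_nonneg _) (Real.abs_cos_le_one _)

lemma aux_Gphi (a : ℝ) : ∫ t, auxG a t * gauss t = auxA a := by
  have : ∀ t, auxG a t * gauss t
      = (2*π)⁻¹ * ∫ s, (Real.cos (s * t) * Real.exp (-s^2/2)) * gauss t ∂(auxNu a) := by
    intro t; rw [integral_mul_const, auxG, mul_assoc]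
  simp_rw [this]
  rw [integral_const_mul, integral_integral_swap]
  · unfold auxA; congr 2
    ext s
    have : ∀ t, (Real.cos (s * t) * Real.exp (-s^2/2)) * gauss t
      = Real.exp (-s^2/2) * (Real.cos (s * t) * gauss t) := fun t => by ring
    simp_rw [this]
    rw [integral_const_mul, aux_gauss_cos, ← Real.exp_add]; congr 1; ring
  · have h1 : Integrable (fun z : ℝ × ℝ => gauss z.1 * (1:ℝ)) (volume.prod (auxNu a)) :=
      aux_gauss_int.mul_prod (integrable_const (1:ℝ))
    refine h1.mono ?_ (Filter.Eventually.of_forall fun z => ?_)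
    · have := aux_gauss_cont
      apply Continuous.aestronglyMeasurable
      unfold Function.uncurry; fun_prop
    · simp only [Function.uncurry, mul_one]
      rw [norm_mul]
      exact mul_le_of_le_one_left (norm_nonneg _) (aux_cw_le _ _)

lemma aux_tail (a : ℝ) (ha : 0 ≤ a) :
    ∫ s in Set.Ioi a, Real.exp (-s^2) ≤ Real.exp (-a^2) * (√π / 2) := by
  have h0 := integral_gaussian_Ioi 1
  rw [div_one] at h0
  rw [← h0, ← integral_const_mul]
  have hI : Integrable (fun s : ℝ => Real.exp (-s^2)) := by
    simpa using integrable_exp_neg_mul_sq (b := 1) one_pos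
  have e : ∫ s in Set.Ioi a, Real.exp (-s^2) = ∫ s in Set.Ioi 0, Real.exp (-(s + a)^2) := by
    rw [← integral_indicator measurableSet_Ioi, ← integral_indicator measurableSet_Ioi,
      ← integral_add_right_eq_self _ a]
    congr 1; ext s
    simp [Set.indicator]
  rw [e]
  refine setIntegral_mono_on (hI.comp_add_right a).integrableOn ?_ measurableSet_Ioi ?_
  · exact ((integrable_exp_neg_mul_sq (b := 1) one_pos).const_mul _).integrableOn
  · intro s hs
    rw [← Real.exp_add, Real.exp_le_exp]
    have : 0 < s := hs
    nlinarith [mul_nonneg this.le ha]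

lemma aux_A_lower (a : ℝ) (ha : 0 ≤ a) :
    1 / (2 * √π) * (1 - Real.exp (-a^2)) ≤ auxA a := by
  have hI : Integrable (fun s : ℝ => Real.exp (-s^2)) := by
    simpa using integrable_exp_neg_mul_sq (b := 1) one_pos
  have h1 := intervalIntegral.integral_Iic_add_Ioi (b := a) hI.integrableOn hI.integrableOn
  have h2 := intervalIntegral.integral_Iic_sub_Iic (a := -a) (b := a) hI.integrableOn hI.integrableOn
  rw [intervalIntegral.integral_of_le (by linarith)] at h2
  have h3 := integral_comp_neg_Ioi a (fun s : ℝ => Real.exp (-s^2))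
  simp only [neg_sq] at h3
  have h4 := aux_tail a ha
  have h5 := integral_gaussian 1
  rw [div_one] at h5
  simp only [neg_mul, one_mul] at h5
  have h6 : √π * (1 - Real.exp (-a^2)) ≤ ∫ s in Set.Ioc (-a) a, Real.exp (-s^2) := by
    linarith
  unfold auxA auxNu
  have : 1 / (2 * √π) * (1 - Real.exp (-a^2)) = (2*π)⁻¹ * (√π * (1 - Real.exp (-a^2))) := by
    have : π = √π * √π := (Real.mul_self_sqrt Real.pi_pos.le).symm
    have h0 : 0 < √π := by positivity
    field_simp
    rw [Real.sq_sqrt Real.pi_pos.le]; ring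
  rw [this]; gcongr

noncomputable def auxKer (b s r : ℝ) : ℝ :=
  2⁻¹ * (√(π / b) * Real.exp (-(r-s)^2/(4*b)) + √(π / b) * Real.exp (-(r+s)^2/(4*b)))

lemma aux_ker (b : ℝ) (hb : 0 < b) (s r : ℝ) :
    ∫ t : ℝ, Real.cos (s * t) * Real.cos (r * t) * Real.exp (-b * t^2) = auxKer b s r := by
  have : ∀ t : ℝ, Real.cos (s * t) * Real.cos (r * t) * Real.exp (-b * t^2)
      = 2⁻¹ * (Real.cos ((r - s) * t) * Real.exp (-b * t^2)
        + Real.cos ((r + s) * t) * Real.exp (-b * t^2)) := by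
    intro t
    rw [sub_mul, add_mul, Real.cos_sub, Real.cos_add]; ring
  have hi : ∀ c : ℝ, Integrable (fun t : ℝ => Real.cos (c * t) * Real.exp (-b * t^2)) := by
    intro c
    refine (integrable_exp_neg_mul_sq hb).bdd_mul (c := 1) (by fun_prop)
      (Filter.Eventually.of_forall fun t => ?_)
    exact Real.abs_cos_le_one _
  simp_rw [this]
  rw [integral_const_mul, integral_add (hi _) (hi _), aux_cosG b hb, aux_cosG b hb, auxKer]

lemma aux_ker_symm (b s r : ℝ) : auxKer b s r = auxKer b r s := by
  unfold auxKer
  have h1 : (r-s)^2 = (s-r)^2 := by ring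
  rw [h1, add_comm r s]

lemma aux_ker_nonneg (b s r : ℝ) : 0 ≤ auxKer b s r := by
  unfold auxKer; positivity

lemma aux_ker_cont (b : ℝ) : Continuous (fun z : ℝ × ℝ => auxKer b z.1 z.2) := by
  unfold auxKer; fun_prop

lemma aux_ker_le (b s r : ℝ) (hb : 0 < b) : auxKer b s r ≤ √(π/b) := by
  unfold auxKer
  have h1 : Real.exp (-(r-s)^2/(4*b)) ≤ 1 := Real.exp_le_one_iff.2 (by
    apply div_nonpos_of_nonpos_of_nonneg <;> nlinarith [sq_nonneg (r-s)])
  have h2 : Real.exp (-(r+s)^2/(4*b)) ≤ 1 := Real.exp_le_one_iff.2 (by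
    apply div_nonpos_of_nonpos_of_nonneg <;> nlinarith [sq_nonneg (r+s)])
  have h3 : 0 ≤ √(π/b) := by positivity
  nlinarith [mul_le_mul_of_nonneg_left h1 h3, mul_le_mul_of_nonneg_left h2 h3]

lemma aux_ker_int (b : ℝ) (hb : 0 < b) (s : ℝ) :
    Integrable (fun r => auxKer b s r) ∧ ∫ r, auxKer b s r = 2 * π := by
  have hp : 0 < 1/(4*b) := by positivity
  have hi := integrable_exp_neg_mul_sq hp
  have hv := integral_gaussian (1/(4*b))
  have e : ∀ r, auxKer b s r = 2⁻¹ * (√(π / b) * Real.exp (-(1/(4*b)) * (r-s)^2)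
      + √(π / b) * Real.exp (-(1/(4*b)) * (r+s)^2)) := by
    intro r; unfold auxKer
    have h1 : -(r-s)^2/(4*b) = -(1/(4*b)) * (r-s)^2 := by ring
    have h2 : -(r+s)^2/(4*b) = -(1/(4*b)) * (r+s)^2 := by ring
    rw [h1, h2]
  simp_rw [e]
  have i1 := (hi.comp_sub_right s).const_mul (√(π/b))
  have i2 := (hi.comp_add_right s).const_mul (√(π/b))
  refine ⟨(i1.add i2).const_mul _, ?_⟩
  rw [integral_const_mul, integral_add i1 i2, integral_const_mul, integral_const_mul,
    integral_sub_right_eq_self (fun r => Real.exp (-(1/(4*b)) * r^2)) s,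
    integral_add_right_eq_self (fun r => Real.exp (-(1/(4*b)) * r^2)) s, hv]
  have : √(π/b) * √(π/(1/(4*b))) = 2 * π := by
    rw [← Real.sqrt_mul (by positivity)]
    have : π/b * (π/(1/(4*b))) = (2*π)^2 := by field_simp; ring
    rw [this, Real.sqrt_sq (by positivity)]
  linarith

lemma aux_schur (a b : ℝ) (hb : 0 < b) :
    ∫ z : ℝ × ℝ, Real.exp (-z.1^2/2) * Real.exp (-z.2^2/2) * auxKer b z.1 z.2
      ∂((auxNu a).prod (auxNu a)) ≤ 2 * π * ∫ s, Real.exp (-s^2) ∂(auxNu a) := by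
  have hbd : ∀ s r : ℝ, ‖Real.exp (-s^2) * auxKer b s r‖ ≤ √(π/b) := by
    intro s r
    rw [Real.norm_eq_abs, abs_of_nonneg (mul_nonneg (Real.exp_pos _).le (aux_ker_nonneg _ _ _))]
    exact (mul_le_of_le_one_left (aux_ker_nonneg _ _ _)
      (Real.exp_le_one_iff.2 (by nlinarith [sq_nonneg s]))).trans (aux_ker_le b s r hb)
  have hc := aux_ker_cont b
  have i1 : Integrable (fun z : ℝ × ℝ => Real.exp (-z.1^2) * auxKer b z.1 z.2)
      ((auxNu a).prod (auxNu a)) :=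
    Integrable.of_bound (Continuous.aestronglyMeasurable (by fun_prop)) _
      (Filter.Eventually.of_forall fun z => hbd z.1 z.2)
  have i2 : Integrable (fun z : ℝ × ℝ => Real.exp (-z.2^2) * auxKer b z.1 z.2)
      ((auxNu a).prod (auxNu a)) :=
    Integrable.of_bound (Continuous.aestronglyMeasurable (by fun_prop)) _
      (Filter.Eventually.of_forall fun z => by rw [aux_ker_symm]; exact hbd z.2 z.1)
  have hin : ∀ s, ∫ r, Real.exp (-s^2) * auxKer b s r ∂(auxNu a) ≤ 2 * π * Real.exp (-s^2) := by
    intro s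
    rw [integral_const_mul, mul_comm]
    obtain ⟨k1, k2⟩ := aux_ker_int b hb s
    rw [← k2]
    refine mul_le_mul_of_nonneg_right ?_ (Real.exp_pos _).le
    exact setIntegral_le_integral k1 (Filter.Eventually.of_forall fun r => aux_ker_nonneg _ _ _)
  have hw : Integrable (fun s : ℝ => 2 * π * Real.exp (-s^2)) (auxNu a) := by
    have : Integrable (fun s : ℝ => Real.exp (-s^2)) := by
      simpa using integrable_exp_neg_mul_sq (b := 1) one_pos
    exact (this.const_mul _).restrict
  have v1 : ∫ z : ℝ × ℝ, Real.exp (-z.1^2) * auxKer b z.1 z.2 ∂((auxNu a).prod (auxNu a))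
      ≤ 2 * π * ∫ s, Real.exp (-s^2) ∂(auxNu a) := by
    rw [integral_prod _ i1, ← integral_const_mul]
    exact integral_mono i1.integral_prod_left hw hin
  have v2 : ∫ z : ℝ × ℝ, Real.exp (-z.2^2) * auxKer b z.1 z.2 ∂((auxNu a).prod (auxNu a))
      ≤ 2 * π * ∫ s, Real.exp (-s^2) ∂(auxNu a) := by
    rw [integral_prod_symm _ i2, ← integral_const_mul]
    refine integral_mono i2.integral_prod_right hw (fun s => ?_)
    simp only [aux_ker_symm b _ s]
    exact hin s
  have v3 : ∫ z : ℝ × ℝ, Real.exp (-z.1^2/2) * Real.exp (-z.2^2/2) * auxKer b z.1 z.2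
      ∂((auxNu a).prod (auxNu a)) ≤
      ∫ z : ℝ × ℝ, 2⁻¹ * (Real.exp (-z.1^2) * auxKer b z.1 z.2
        + Real.exp (-z.2^2) * auxKer b z.1 z.2) ∂((auxNu a).prod (auxNu a)) := by
    refine integral_mono_of_nonneg (Filter.Eventually.of_forall fun z => ?_)
      ((i1.add i2).const_mul _) (Filter.Eventually.of_forall fun z => ?_)
    · exact mul_nonneg (by positivity) (aux_ker_nonneg _ _ _)
    · have e1 : Real.exp (-z.1^2) = Real.exp (-z.1^2/2) * Real.exp (-z.1^2/2) := by
        rw [← Real.exp_add]; congr 1; ring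
      have e2 : Real.exp (-z.2^2) = Real.exp (-z.2^2/2) * Real.exp (-z.2^2/2) := by
        rw [← Real.exp_add]; congr 1; ring
      simp only [e1, e2]
      rw [← add_mul, ← mul_assoc]
      refine mul_le_mul_of_nonneg_right ?_ (aux_ker_nonneg _ _ _)
      nlinarith [sq_nonneg (Real.exp (-z.1^2/2) - Real.exp (-z.2^2/2))]
  rw [integral_const_mul, integral_add i1 i2] at v3
  linarith

lemma aux_G_damped (a b : ℝ) (hb : 0 < b) :
    ∫ t, auxG a t * auxG a t * Real.exp (-b * t^2) ≤ auxA a := by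
  have e : ∀ t, auxG a t * auxG a t * Real.exp (-b * t^2)
      = ((2*π)⁻¹ * (2*π)⁻¹) * ∫ z : ℝ × ℝ, ((Real.cos (z.1 * t) * Real.exp (-z.1^2/2)) *
          (Real.cos (z.2 * t) * Real.exp (-z.2^2/2))) * Real.exp (-b * t^2)
          ∂((auxNu a).prod (auxNu a)) := by
    intro t
    rw [integral_mul_const, integral_prod_mul (fun s => Real.cos (s * t) * Real.exp (-s^2/2))
      (fun s => Real.cos (s * t) * Real.exp (-s^2/2)), auxG]; ring
  simp_rw [e]
  rw [integral_const_mul, integral_integral_swap]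
  · have e2 : ∀ z : ℝ × ℝ, ∫ t : ℝ, ((Real.cos (z.1 * t) * Real.exp (-z.1^2/2)) *
          (Real.cos (z.2 * t) * Real.exp (-z.2^2/2))) * Real.exp (-b * t^2)
          = Real.exp (-z.1^2/2) * Real.exp (-z.2^2/2) * auxKer b z.1 z.2 := by
      intro z
      rw [← aux_ker b hb, ← integral_const_mul]
      congr 1; ext t; ring
    simp_rw [e2]
    have := aux_schur a b hb
    unfold auxA
    calc _ ≤ ((2*π)⁻¹ * (2*π)⁻¹) * (2 * π * ∫ s, Real.exp (-s^2) ∂(auxNu a)) := by gcongr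
      _ = _ := by field_simp
  · have h1 : Integrable (fun z : ℝ × (ℝ × ℝ) => Real.exp (-b * z.1^2) * (1:ℝ))
        (volume.prod ((auxNu a).prod (auxNu a))) :=
      (integrable_exp_neg_mul_sq hb).mul_prod (integrable_const (1:ℝ))
    refine h1.mono ?_ (Filter.Eventually.of_forall fun z => ?_)
    · apply Continuous.aestronglyMeasurable
      unfold Function.uncurry; fun_prop
    · simp only [Function.uncurry, mul_one]
      rw [norm_mul, norm_mul]
      exact mul_le_of_le_one_left (norm_nonneg _)
        (mul_le_one₀ (aux_cw_le _ _) (norm_nonneg _) (aux_cw_le _ _))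

lemma aux_G_lint (a : ℝ) :
    ∫⁻ t, ENNReal.ofReal (auxG a t * auxG a t) ≤ ENNReal.ofReal (auxA a) := by
  have hc := aux_G_cont a
  obtain ⟨C, hC0, hC⟩ := aux_G_bdd a
  let F : ℕ → ℝ → ℝ≥0∞ := fun n t =>
    ENNReal.ofReal (auxG a t * auxG a t * Real.exp (-(1/((n:ℝ)+1)) * t^2))
  have hF : ∀ n, ∫⁻ t, F n t ≤ ENNReal.ofReal (auxA a) := by
    intro n
    have hb : (0:ℝ) < 1/((n:ℝ)+1) := by positivity
    rw [← ofReal_integral_eq_lintegral_ofReal]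
    · exact ENNReal.ofReal_le_ofReal (aux_G_damped a _ hb)
    · refine (integrable_exp_neg_mul_sq hb).bdd_mul (c := C * C)
        (Continuous.aestronglyMeasurable (by fun_prop)) (Filter.Eventually.of_forall fun t => ?_)
      rw [norm_mul]
      exact mul_le_mul (hC t) (hC t) (norm_nonneg _) hC0
    · exact Filter.Eventually.of_forall fun t =>
        mul_nonneg (mul_self_nonneg _) (Real.exp_pos _).le
  have hlim : ∀ t, Filter.liminf (fun n => F n t) Filter.atTop
      = ENNReal.ofReal (auxG a t * auxG a t) := by
    intro t
    apply Filter.Tendsto.liminf_eq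
    apply ENNReal.tendsto_ofReal
    have h1 : Filter.Tendsto (fun n : ℕ => Real.exp (-(1/((n:ℝ)+1)) * t^2)) Filter.atTop (nhds 1) := by
      have := (tendsto_one_div_add_atTop_nhds_zero_nat (𝕜 := ℝ)).neg.mul_const (t^2)
      simpa [Function.comp_def] using (Real.continuous_exp.tendsto _).comp this
    simpa using h1.const_mul (auxG a t * auxG a t)
  calc ∫⁻ t, ENNReal.ofReal (auxG a t * auxG a t)
      = ∫⁻ t, Filter.liminf (fun n => F n t) Filter.atTop := by simp_rw [hlim]
    _ ≤ Filter.liminf (fun n => ∫⁻ t, F n t) Filter.atTop := by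
        apply lintegral_liminf_le
        intro n
        apply Measurable.ennreal_ofReal
        exact Continuous.measurable (by fun_prop)
    _ ≤ Filter.liminf (fun _ : ℕ => ENNReal.ofReal (auxA a)) Filter.atTop := by
        refine Filter.liminf_le_liminf ?_
        exact Filter.Eventually.of_forall hF
    _ = _ := by simp

lemma aux_G_sq (a : ℝ) :
    Integrable (fun t => auxG a t * auxG a t) ∧ ∫ t, auxG a t * auxG a t ≤ auxA a := by
  have hc := aux_G_cont a
  have hA : 0 ≤ auxA a := by
    unfold auxA
    exact mul_nonneg (by positivity) (integral_nonneg fun s => (Real.exp_pos _).le)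
  have hnn : ∀ t, 0 ≤ auxG a t * auxG a t := fun t => mul_self_nonneg _
  have hi : Integrable (fun t => auxG a t * auxG a t) := by
    refine ⟨Continuous.aestronglyMeasurable (by fun_prop), ?_⟩
    rw [hasFiniteIntegral_iff_ofReal (Filter.Eventually.of_forall hnn)]
    exact (aux_G_lint a).trans_lt ENNReal.ofReal_lt_top
  refine ⟨hi, ?_⟩
  have := aux_G_lint a
  rw [← ofReal_integral_eq_lintegral_ofReal hi (Filter.Eventually.of_forall hnn)] at this
  exact (ENNReal.ofReal_le_ofReal_iff hA).1 this

lemma aux_Gphi_int (a : ℝ) : Integrable (fun t => auxG a t * gauss t) := by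
  obtain ⟨C, hC0, hC⟩ := aux_G_bdd a
  exact aux_gauss_int.bdd_mul (c := C) (aux_G_cont a).aestronglyMeasurable
    (Filter.Eventually.of_forall hC)

/-- kernel difference -/
noncomputable def auxD (d : ℕ) (a : ℝ) (x : Fin d → ℝ) : ℝ :=
  ∏ i, auxG a (x i) - ∏ i, gauss (x i)

lemma aux_D_cont (d : ℕ) (a : ℝ) : Continuous (auxD d a) := by
  have h1 := aux_G_cont a
  have h2 := aux_gauss_cont
  unfold auxD; fun_prop

lemma aux_D_lint (d : ℕ) (a : ℝ) (ha : 0 ≤ a) :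
    ∫⁻ x, ENNReal.ofReal ((auxD d a x)^2)
      ≤ ENNReal.ofReal (d * (1 / (2 * √π))^d * Real.exp (-a^2)) := by
  obtain ⟨g1, g2⟩ := aux_G_sq a
  have e : ∀ x : Fin d → ℝ, (auxD d a x)^2 = ∏ i, (auxG a (x i) * auxG a (x i))
      - 2 * ∏ i, (auxG a (x i) * gauss (x i)) + ∏ i, (gauss (x i) * gauss (x i)) := by
    intro x; unfold auxD; simp only [Finset.prod_mul_distrib]; ring
  have i1 : Integrable (fun x : Fin d → ℝ => ∏ i, (auxG a (x i) * auxG a (x i))) :=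
    Integrable.fintype_prod (f := fun _ t => auxG a t * auxG a t) (fun _ => g1)
  have i2 : Integrable (fun x : Fin d → ℝ => ∏ i, (auxG a (x i) * gauss (x i))) :=
    Integrable.fintype_prod (f := fun _ t => auxG a t * gauss t) (fun _ => aux_Gphi_int a)
  have i3 : Integrable (fun x : Fin d → ℝ => ∏ i, (gauss (x i) * gauss (x i))) :=
    Integrable.fintype_prod (f := fun _ t => gauss t * gauss t) (fun _ => aux_gauss_sq_int)
  have v1 := integral_fintype_prod_volume_eq_pow (ι := Fin d) (fun t => auxG a t * auxG a t)
  have v2 := integral_fintype_prod_volume_eq_pow (ι := Fin d) (fun t => auxG a t * gauss t)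
  have v3 := integral_fintype_prod_volume_eq_pow (ι := Fin d) (fun t => gauss t * gauss t)
  rw [Fintype.card_fin] at v1 v2 v3
  rw [aux_Gphi] at v2
  rw [aux_gauss_sq] at v3
  simp_rw [e]
  have i4 : Integrable (fun x : Fin d → ℝ => ∏ i, (auxG a (x i) * auxG a (x i))
      - 2 * ∏ i, (auxG a (x i) * gauss (x i)) + ∏ i, (gauss (x i) * gauss (x i))) :=
    (i1.sub (i2.const_mul 2)).add i3
  rw [← ofReal_integral_eq_lintegral_ofReal i4
    (Filter.Eventually.of_forall fun x => by
      have := sq_nonneg (auxD d a x); rw [e] at this; exact this)]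
  apply ENNReal.ofReal_le_ofReal
  have : ∫ x : Fin d → ℝ, (∏ i, (auxG a (x i) * auxG a (x i))
      - 2 * ∏ i, (auxG a (x i) * gauss (x i)) + ∏ i, (gauss (x i) * gauss (x i)))
      = (∫ t, auxG a t * auxG a t)^d - 2 * (auxA a)^d + (1 / (2 * √π))^d := by
    have i5 : Integrable (fun x : Fin d → ℝ => ∏ i, (auxG a (x i) * auxG a (x i))
      - 2 * ∏ i, (auxG a (x i) * gauss (x i))) := i1.sub (i2.const_mul 2)
    rw [integral_add i5 i3, integral_sub i1 (i2.const_mul 2),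
      integral_const_mul, v1, v2, v3]
  rw [this]
  have hB : 0 < 1 / (2 * √π) := by positivity
  have hE : Real.exp (-a^2) ≤ 1 := Real.exp_le_one_iff.2 (by nlinarith [sq_nonneg a])
  have hg : (∫ t, auxG a t * auxG a t)^d ≤ (auxA a)^d :=
    pow_le_pow_left₀ (integral_nonneg fun t => mul_self_nonneg _) g2 d
  have hA : (1 / (2 * √π))^d * (1 - Real.exp (-a^2))^d ≤ (auxA a)^d := by
    rw [← mul_pow]
    exact pow_le_pow_left₀ (mul_nonneg hB.le (by linarith)) (aux_A_lower a ha) d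
  have hber := one_add_mul_le_pow (a := -Real.exp (-a^2)) (by linarith) d
  rw [← sub_eq_add_neg] at hber
  have hBd : 0 < (1 / (2 * √π))^d := by positivity
  have := mul_le_mul_of_nonneg_left hber hBd.le
  nlinarith

lemma aux_sincK_meas : Measurable sincK := by
  unfold sincK
  refine Measurable.ite (measurableSet_singleton (0:ℝ)) measurable_const ?_
  fun_prop

lemma aux_sincK_le (y : ℝ) : |sincK y| ≤ 1 := by
  have hp : 1 < π := by linarith [Real.pi_gt_three]
  unfold sincK
  split_ifs with h
  · rw [abs_of_pos (by positivity), div_le_one (by positivity)]; exact hp.le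
  · have : 0 < |y| := abs_pos.2 h
    rw [abs_div, abs_mul, abs_of_pos Real.pi_pos, div_le_one (by positivity)]
    have := Real.abs_sin_le_abs (x := y)
    nlinarith

section mix
variable {d : ℕ} (G : Measure (Fin d → ℝ)) [IsProbabilityMeasure G]

lemma aux_P_meas (h : ℝ) (x : Fin d → ℝ) :
    Measurable (fun y : Fin d → ℝ => ∏ j, sincK ((y j - x j)/h)) := by
  have := aux_sincK_meas
  fun_prop

lemma aux_P_le (h : ℝ) (x y : Fin d → ℝ) : ‖∏ j, sincK ((y j - x j)/h)‖ ≤ 1 := by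
  rw [norm_prod]
  exact Finset.prod_le_one (fun _ _ => norm_nonneg _) (fun _ _ => aux_sincK_le _)

lemma aux_gp_cont : Continuous (fun z : (Fin d → ℝ) × (Fin d → ℝ) => ∏ i, gauss (z.1 i - z.2 i)) := by
  have := aux_gauss_cont
  fun_prop

lemma aux_gp_nonneg (y u : Fin d → ℝ) : 0 ≤ ∏ i, gauss (y i - u i) :=
  Finset.prod_nonneg fun _ _ => (aux_gauss_pos _).le

lemma aux_gp_le (y u : Fin d → ℝ) : ‖∏ i, gauss (y i - u i)‖ ≤ 1 := by
  rw [Real.norm_eq_abs, abs_of_nonneg (aux_gp_nonneg _ _)]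
  exact Finset.prod_le_one (fun _ _ => (aux_gauss_pos _).le) (fun _ _ => aux_gauss_le _)

lemma aux_gp_int (u : Fin d → ℝ) : Integrable (fun y : Fin d → ℝ => ∏ i, gauss (y i - u i)) :=
  Integrable.fintype_prod (f := fun i t => gauss (t - u i))
    (fun i => aux_gauss_int.comp_sub_right (u i))

lemma aux_gp_one (u : Fin d → ℝ) : ∫ y : Fin d → ℝ, ∏ i, gauss (y i - u i) = 1 := by
  rw [integral_fintype_prod_volume_eq_prod (fun i t => gauss (t - u i))]
  simp [integral_sub_right_eq_self, aux_gauss_one]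

lemma aux_joint : Integrable (fun z : (Fin d → ℝ) × (Fin d → ℝ) => ∏ i, gauss (z.1 i - z.2 i))
    (volume.prod G) := by
  rw [integrable_prod_iff' aux_gp_cont.aestronglyMeasurable]
  refine ⟨Filter.Eventually.of_forall fun u => aux_gp_int u, ?_⟩
  have : ∀ u : Fin d → ℝ, ∫ y : Fin d → ℝ, ‖∏ i, gauss (y i - u i)‖ = 1 := by
    intro u
    rw [← aux_gp_one u]
    congr 1; ext y
    rw [Real.norm_eq_abs, abs_of_nonneg (aux_gp_nonneg _ _)]
  simp only [this]
  exact integrable_const _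

lemma aux_mix_cont : Continuous (mixDensity d G) := by
  have hg := aux_gauss_cont
  unfold mixDensity
  refine continuous_of_dominated (bound := fun _ => 1)
    (fun t => Continuous.aestronglyMeasurable (by fun_prop)) ?_ (integrable_const _) ?_
  · intro t; exact Filter.Eventually.of_forall fun s => aux_gp_le t s
  · exact Filter.Eventually.of_forall fun s => by fun_prop

lemma aux_mix_nonneg (x : Fin d → ℝ) : 0 ≤ mixDensity d G x :=
  integral_nonneg fun u => aux_gp_nonneg x u

lemma aux_mix_int : Integrable (mixDensity d G) := (aux_joint G).integral_prod_left

lemma aux_mix_one : ∫ x, mixDensity d G x = 1 := by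
  unfold mixDensity
  rw [integral_integral_swap (aux_joint G)]
  simp [aux_gp_one]

lemma aux_mix_P (h : ℝ) (hh : 0 < h) (x : Fin d → ℝ) :
    (1/h)^d * ∫ y, (∏ j, sincK ((y j - x j)/h)) * mixDensity d G y
      = ∫ u, ∏ i, auxG (1/h) (x i - u i) ∂G := by
  have e : ∀ y, (∏ j, sincK ((y j - x j)/h)) * mixDensity d G y
      = ∫ u, (∏ j, sincK ((y j - x j)/h)) * ∏ i, gauss (y i - u i) ∂G := by
    intro y; rw [integral_const_mul]; rfl
  simp_rw [e]
  rw [integral_integral_swap]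
  · rw [← integral_const_mul]
    congr 1; ext u
    simp_rw [← Finset.prod_mul_distrib]
    rw [integral_fintype_prod_volume_eq_prod
      (fun i t => sincK ((t - x i)/h) * gauss (t - u i))]
    simp_rw [← aux_mean1 h hh]
    rw [Finset.prod_mul_distrib]; simp
  · refine (aux_joint G).bdd_mul (c := 1) ?_ (Filter.Eventually.of_forall fun z => aux_P_le h x z.1)
    exact ((aux_P_meas h x).comp measurable_fst).aestronglyMeasurable

lemma aux_mean (n : ℕ) (hn : 1 ≤ n) (h : ℝ) (hh : 0 < h) (x : Fin d → ℝ) :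
    sincEstMean d n (mixDensity d G) h x = ∫ u, ∏ i, auxG (1/h) (x i - u i) ∂G := by
  rw [← aux_mix_P G h hh x]
  set f := mixDensity d G with hf
  have fc : Continuous f := aux_mix_cont G
  have fi : Integrable f := aux_mix_int G
  have f1 : ∫ x, f x = 1 := aux_mix_one G
  have f0 : ∀ x, 0 ≤ f x := aux_mix_nonneg G
  set P : (Fin d → ℝ) → ℝ := fun y => ∏ j, sincK ((y j - x j)/h) with hP
  have Pi : Integrable (fun y => P y * f y) :=
    fi.bdd_mul (c := 1) (aux_P_meas h x).aestronglyMeasurable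
      (Filter.Eventually.of_forall fun y => aux_P_le h x y)
  unfold sincEstMean jointMeasure
  rw [integral_withDensity_eq_integral_toReal_smul]
  rotate_left
  · refine Finset.measurable_prod _ fun i _ => ?_
    exact (fc.measurable.comp (measurable_pi_apply i)).ennreal_ofReal
  · refine Filter.Eventually.of_forall fun X => ?_
    exact ENNReal.prod_lt_top fun i _ => ENNReal.ofReal_lt_top
  have e : ∀ X : Fin n → Fin d → ℝ,
      (∏ i, ENNReal.ofReal (f (X i))).toReal • sincEst d n h X x
      = (1 / (n * h^d)) * ∑ i : Fin n, ∏ k : Fin n, ((if k = i then P (X k) else 1) * f (X k)) := by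
    intro X
    rw [ENNReal.toReal_prod]
    simp only [ENNReal.toReal_ofReal (f0 _), Finset.prod_mul_distrib, Finset.prod_ite_eq', Finset.mem_univ, if_true,
      ← Finset.sum_mul, smul_eq_mul, sincEst, hP]
    ring
  simp_rw [e]
  have hi : ∀ i k : Fin n, Integrable (fun y => (if k = i then P y else 1) * f y) := by
    intro i k
    by_cases hk : k = i
    · simpa [hk] using Pi
    · simpa [hk] using fi
  rw [integral_const_mul, integral_finsetSum]
  · have : ∀ i : Fin n, ∫ X : Fin n → Fin d → ℝ, ∏ k : Fin n, ((if k = i then P (X k) else 1) * f (X k))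
        = ∫ y, P y * f y := by
      intro i
      rw [integral_fintype_prod_volume_eq_prod (fun k y => (if k = i then P y else 1) * f y)]
      rw [Finset.prod_eq_single i]
      · simp
      · intro k _ hk; simp [hk, f1]
      · simp
    simp_rw [this]
    have hn' : (n:ℝ) ≠ 0 := by positivity
    simp only [Finset.sum_const, Finset.card_univ, Fintype.card_fin, nsmul_eq_mul, one_div, inv_pow]
    field_simp
    rfl
  · intro i _
    exact Integrable.fintype_prod (f := fun k y => (if k = i then P y else 1) * f y) (hi i)

lemma aux_D_bdd (a : ℝ) : ∃ C, ∀ x : Fin d → ℝ, ‖auxD d a x‖ ≤ C := by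
  obtain ⟨C, hC0, hC⟩ := aux_G_bdd a
  refine ⟨∏ _i : Fin d, C + 1, fun x => ?_⟩
  unfold auxD
  refine (norm_sub_le _ _).trans (add_le_add ?_ ?_)
  · rw [norm_prod]
    exact Finset.prod_le_prod (fun _ _ => norm_nonneg _) (fun _ _ => hC _)
  · simpa using aux_gp_le x 0

lemma aux_bias (n : ℕ) (hn : 1 ≤ n) (h : ℝ) (hh : 0 < h) (x : Fin d → ℝ) :
    sincEstMean d n (mixDensity d G) h x - mixDensity d G x
      = ∫ u, auxD d (1/h) (x - u) ∂G := by
  rw [aux_mean G n hn h hh]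
  have hc1 := aux_G_cont (1/h)
  have hc2 := aux_gauss_cont
  unfold mixDensity auxD
  rw [← integral_sub]
  · rfl
  · obtain ⟨C, hC0, hC⟩ := aux_G_bdd (1/h)
    refine Integrable.of_bound (Continuous.aestronglyMeasurable (by fun_prop)) (∏ _i : Fin d, C)
      (Filter.Eventually.of_forall fun u => ?_)
    rw [norm_prod]
    exact Finset.prod_le_prod (fun _ _ => norm_nonneg _) (fun _ _ => hC _)
  · exact Integrable.of_bound (Continuous.aestronglyMeasurable (by fun_prop)) 1
      (Filter.Eventually.of_forall fun u => aux_gp_le x u)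

lemma aux_jensen (F : (Fin d → ℝ) → ℝ) (hF : Continuous F) (C : ℝ) (hC : ∀ u, ‖F u‖ ≤ C) :
    ENNReal.ofReal ((∫ u, F u ∂G)^2) ≤ ∫⁻ u, ENNReal.ofReal ((F u)^2) ∂G := by
  have i1 : Integrable F G := Integrable.of_bound hF.aestronglyMeasurable C
    (Filter.Eventually.of_forall hC)
  have i2 : Integrable (fun u => (F u)^2) G :=
    Integrable.of_bound (hF.pow 2).aestronglyMeasurable (C^2)
      (Filter.Eventually.of_forall fun u => by
        rw [norm_pow]; exact pow_le_pow_left₀ (norm_nonneg _) (hC u) 2)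
  rw [← ofReal_integral_eq_lintegral_ofReal i2 (Filter.Eventually.of_forall fun u => sq_nonneg _)]
  apply ENNReal.ofReal_le_ofReal
  set m := ∫ u, F u ∂G with hm
  have h0 : 0 ≤ ∫ u, ((F u)^2 - 2 * m * F u + m^2) ∂G :=
    integral_nonneg fun u => by
      have := sq_nonneg (F u - m)
      simp only [Pi.zero_apply]; nlinarith
  have i3 : Integrable (fun u => (F u)^2 - 2 * m * F u) G := i2.sub (i1.const_mul _)
  rw [integral_add i3 (integrable_const _), integral_sub i2 (i1.const_mul _),
    integral_const_mul, ← hm] at h0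
  simp at h0
  nlinarith

end mix

theorem stmt8 (d n : ℕ) (hd : 1 ≤ d) (hn : 1 ≤ n)
    (f : (Fin d → ℝ) → ℝ) (hf : f ∈ gaussMixtures d) (h : ℝ) (hh : 0 < h) :
    (∫⁻ x, ENNReal.ofReal ((sincEstMean d n f h x - f x)^2))
      ≤ ENNReal.ofReal
          (d * 2 ^ (1 - (d : ℝ)) * Real.pi ^ (-(d : ℝ)/2) * Real.exp (-1/h^2)) := by
  obtain ⟨G, hG, rfl⟩ := hf
  simp_rw [aux_bias G n hn h hh]
  have hDc := aux_D_cont d (1/h)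
  obtain ⟨C, hC⟩ := aux_D_bdd (d := d) (1/h)
  calc ∫⁻ x, ENNReal.ofReal ((∫ u, auxD d (1/h) (x - u) ∂G)^2)
      ≤ ∫⁻ x, ∫⁻ u, ENNReal.ofReal ((auxD d (1/h) (x - u))^2) ∂G :=
        lintegral_mono fun x => aux_jensen G (fun u => auxD d (1/h) (x - u)) (by fun_prop) C
          (fun u => hC _)
    _ = ∫⁻ u, ∫⁻ x, ENNReal.ofReal ((auxD d (1/h) (x - u))^2) ∂volume ∂G := by
        apply MeasureTheory.lintegral_lintegral_swap
        apply Measurable.aemeasurable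
        apply Measurable.ennreal_ofReal
        exact Continuous.measurable (by fun_prop)
    _ = ∫⁻ _u, ∫⁻ x, ENNReal.ofReal ((auxD d (1/h) x)^2) ∂volume ∂G := by
        congr 1; ext u
        exact MeasureTheory.lintegral_sub_right_eq_self
          (fun x => ENNReal.ofReal ((auxD d (1/h) x)^2)) u
    _ = ∫⁻ x, ENNReal.ofReal ((auxD d (1/h) x)^2) := by simp
    _ ≤ ENNReal.ofReal (d * (1 / (2 * √π))^d * Real.exp (-(1/h)^2)) :=
        aux_D_lint d (1/h) (by positivity)
    _ ≤ _ := by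
        apply ENNReal.ofReal_le_ofReal
        have e1 : -(1/h)^2 = -1/h^2 := by rw [div_pow, one_pow, neg_div]
        have e2 : (1 / (2 * √π))^d = 2 ^ (-(d:ℝ)) * π ^ (-(d:ℝ)/2) := by
          rw [Real.sqrt_eq_rpow, one_div, mul_inv, mul_pow, ← Real.rpow_neg Real.pi_pos.le,
            ← Real.rpow_natCast (π ^ _), ← Real.rpow_mul Real.pi_pos.le,
            Real.rpow_neg (by norm_num), Real.rpow_natCast, inv_pow]
          congr 2; ring
        have e3 : (2:ℝ) ^ (-(d:ℝ)) ≤ 2 ^ (1 - (d:ℝ)) :=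
          Real.rpow_le_rpow_of_exponent_le (by norm_num) (by linarith)
        rw [e1, e2, ← mul_assoc]
        gcongr
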